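/- arXiv:1803.03831 — 6 statements merged into one kernel-verified Lean document; each statement's English description precedes it below -/
import Mathlib

section
/- Let T be a minimum spanning tree of G, let C ⊆ V be a cluster, and let v₁, v₂ ∈ C. Then every vertex lying on the unique path in T from v₁ to v₂ belongs to C. -/
open scoped BigOperators

/-- `T` is a spanning tree of `G`: a connected acyclic subgraph of `G`
(on the same vertex set `V`, hence spanning). -/
def IsSpanningTree {V : Type*} (G T : SimpleGraph V) : Prop :=
  T ≤ G ∧ T.Connected ∧ T.IsAcyclic

/-- Total weight of a graph: the sum of the weights of its edges. -/
noncomputable def totalWeight {V : Type*} (w : Sym2 V → ℝ) (T : SimpleGraph V) : ℝ :=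
  ∑ᶠ e ∈ T.edgeSet, w e

/-- `T` is a minimum spanning tree of `G` with respect to the weight function `w`. -/
def IsMST {V : Type*} (G : SimpleGraph V) (w : Sym2 V → ℝ) (T : SimpleGraph V) : Prop :=
  IsSpanningTree G T ∧ ∀ T' : SimpleGraph V, IsSpanningTree G T' →
    totalWeight w T ≤ totalWeight w T'

/-- The minimum path distance between `u` and `v` in `G`: the minimum over all
paths from `u` to `v` of the sum of the weights of its edges. -/
noncomputable def minDist {V : Type*} (G : SimpleGraph V) (w : Sym2 V → ℝ) (u v : V) : ℝ :=
  sInf {x : ℝ | ∃ p : G.Walk u v, p.IsPath ∧ x = (p.edges.map w).sum}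

/-- `C ⊆ V` is a cluster: `|C| > 2` and for every partition `C = C₁ ∪ C₂` into two
nonempty disjoint sets, every minimizer over `z ∈ V ∖ C₁` of `z ↦ min_{v ∈ C₁} d(z,v)`
belongs to `C₂`. -/
def IsCluster {V : Type*} (G : SimpleGraph V) (w : Sym2 V → ℝ) (C : Set V) : Prop :=
  2 < C.ncard ∧
  ∀ C₁ C₂ : Set V, C = C₁ ∪ C₂ → Disjoint C₁ C₂ → C₁.Nonempty → C₂.Nonempty →
    ∀ z : V, z ∉ C₁ →
      (∀ z' : V, z' ∉ C₁ →
        sInf {x : ℝ | ∃ v ∈ C₁, x = minDist G w z v} ≤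
          sInf {x : ℝ | ∃ v ∈ C₁, x = minDist G w z' v}) →
      z ∈ C₂

theorem totalWeight_mono {V : Type*} [Finite V] {w : Sym2 V → ℝ} {H K : SimpleGraph V}
    (hHK : H ≤ K) (hw : ∀ e ∈ K.edgeSet, 0 ≤ w e) : totalWeight w H ≤ totalWeight w K := by
  have hH : H.edgeSet.Finite := Set.toFinite _
  have hK : K.edgeSet.Finite := Set.toFinite _
  unfold totalWeight
  rw [finsum_mem_eq_finite_toFinset_sum _ hH, finsum_mem_eq_finite_toFinset_sum _ hK]
  refine Finset.sum_le_sum_of_subset_of_nonneg ?_ fun e he _ => hw e (by simpa using he)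
  simpa using hHK

/-- A minimum spanning tree weighs no more than any connected spanning subgraph. -/
theorem IsMST.totalWeight_le_of_connected {V : Type*} [Finite V] {G T H : SimpleGraph V}
    {w : Sym2 V → ℝ} (hT : IsMST G w T) (hw : ∀ e ∈ G.edgeSet, 0 < w e ∧ w e ≤ 1)
    (hHG : H ≤ G) (hH : H.Connected) : totalWeight w T ≤ totalWeight w H := by
  obtain ⟨T', hle, hT'⟩ := hH.exists_isTree_le
  refine (hT.2 T' ⟨hle.trans hHG, hT'.connected, hT'.isAcyclic⟩).trans
    (totalWeight_mono hle fun e he => (hw e ?_).1.le)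
  exact SimpleGraph.edgeSet_mono hHG he

/-- Cycle property: an edge outside a minimum spanning tree is at least as heavy as every edge
of the tree path joining its endpoints. -/
theorem IsMST.weight_le_of_mem_edges {V : Type*} [Finite V] {G T : SimpleGraph V}
    {w : Sym2 V → ℝ} (hT : IsMST G w T) (hw : ∀ e ∈ G.edgeSet, 0 < w e ∧ w e ≤ 1)
    {a b : V} (hab : G.Adj a b) (hTab : ¬ T.Adj a b) {q : T.Walk b a} (hq : q.IsPath)
    {f : Sym2 V} (hf : f ∈ q.edges) : w f ≤ w s(a, b) := by
  have hfT : f ∈ T.edgeSet := q.edges_subset_edgeSet hf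
  have hne : s(a, b) ≠ f := by
    rintro rfl
    exact hTab hfT
  let K := T ⊔ SimpleGraph.edge a b
  have hTK : T ≤ K := le_sup_left
  have hKab : K.Adj a b :=
    Or.inr ((SimpleGraph.edge_adj ..).mpr ⟨Or.inl ⟨rfl, rfl⟩, hab.ne⟩)
  have hcycle : (SimpleGraph.Walk.cons hKab (q.mapLe hTK)).IsCycle := by
    rw [SimpleGraph.Walk.cons_isCycle_iff]
    refine ⟨hq.mapLe hTK, fun h => hTab ?_⟩
    rw [SimpleGraph.Walk.edges_mapLe_eq_edges] at h
    exact q.edges_subset_edgeSet h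
  have hbridge : ¬ K.IsBridge f := fun h => h.notMem_edges_of_isCycle hcycle (by simp [hf])
  have hconn : (K.deleteEdges {f}).Connected := by
    induction f with
    | h x y => exact (hT.1.2.1.mono hTK).connected_delete_edge_of_not_isBridge hbridge
  have hKG : K ≤ G := sup_le hT.1.1 ((SimpleGraph.edge_le_iff ..).mpr (Or.inr hab))
  have hle := hT.totalWeight_le_of_connected hw ((SimpleGraph.deleteEdges_le _).trans hKG) hconn
  have hK : (K.deleteEdges {f}).edgeSet = insert s(a, b) (T.edgeSet \ {f}) := by
    rw [SimpleGraph.edgeSet_deleteEdges, SimpleGraph.edgeSet_sup,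
      SimpleGraph.edgeSet_edge_of_ne hab.ne]
    ext e
    simp only [Set.mem_sdiff, Set.mem_union, Set.mem_singleton_iff, Set.mem_insert_iff]
    grind
  have hTf : T.edgeSet = insert f (T.edgeSet \ {f}) := by
    rw [Set.insert_sdiff_singleton, Set.insert_eq_of_mem hfT]
  unfold totalWeight at hle
  rw [hK, hTf, finsum_mem_insert _ (by simp) (Set.toFinite _), ← hTf,
    finsum_mem_insert _ (fun h => hTab h.1) (Set.toFinite _)] at hle
  linarith

theorem minDist_le_of_adj {V : Type*} {G : SimpleGraph V} {w : Sym2 V → ℝ}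
    (hw : ∀ e ∈ G.edgeSet, 0 < w e ∧ w e ≤ 1) {a b : V} (hab : G.Adj a b) :
    minDist G w a b ≤ w s(a, b) := by
  refine csInf_le ⟨0, ?_⟩ ⟨hab.toWalk, SimpleGraph.Walk.IsPath.of_adj hab, by simp⟩
  rintro x ⟨p, -, rfl⟩
  refine List.sum_nonneg fun y hy => ?_
  obtain ⟨e, he, rfl⟩ := List.mem_map.mp hy
  exact (hw e (p.edges_subset_edgeSet he)).1.le

/-- A lower bound on the weights of the edges leaving `S` bounds from below the distance
between a vertex outside `S` and a vertex of `S`. -/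
theorem le_minDist_of_le_crossing {V : Type*} {G : SimpleGraph V} {w : Sym2 V → ℝ}
    (hG : G.Connected) (hw : ∀ e ∈ G.edgeSet, 0 < w e ∧ w e ≤ 1) {S : Set V} {m : ℝ}
    (hm : ∀ a ∈ S, ∀ b ∉ S, G.Adj a b → m ≤ w s(a, b)) {z v : V} (hz : z ∉ S) (hv : v ∈ S) :
    m ≤ minDist G w z v := by
  classical
  obtain ⟨p₀⟩ := hG.preconnected z v
  refine le_csInf ⟨_, p₀.toPath.1, p₀.toPath.2, rfl⟩ ?_
  rintro x ⟨p, -, rfl⟩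
  obtain ⟨d, hd, hfst, hsnd⟩ := p.exists_boundary_dart Sᶜ hz (by simpa using hv)
  have hmem : d.edge ∈ p.edges := List.mem_map_of_mem hd
  have hle : m ≤ w d.edge := by
    have := hm d.snd (by simpa using hsnd) d.fst hfst d.adj.symm
    rwa [Sym2.eq_swap] at this
  refine hle.trans (List.single_le_sum ?_ _ (List.mem_map_of_mem hmem))
  intro y hy
  obtain ⟨e, he, rfl⟩ := List.mem_map.mp hy
  exact (hw e (p.edges_subset_edgeSet he)).1.le

/-- A lightest edge leaving a nonempty proper subset of a cluster ends in the cluster. -/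
theorem IsCluster.mem_of_lightest_crossing {V : Type*} {G : SimpleGraph V} {w : Sym2 V → ℝ}
    (hG : G.Connected) (hw : ∀ e ∈ G.edgeSet, 0 < w e ∧ w e ≤ 1) {C S : Set V}
    (hC : IsCluster G w C) (hSC : S ⊂ C) {a b : V} (ha : a ∈ S) (hb : b ∉ S) (hab : G.Adj a b)
    (hmin : ∀ a' ∈ S, ∀ b' ∉ S, G.Adj a' b' → w s(a, b) ≤ w s(a', b')) : b ∈ C := by
  have hlow {z : V} (hz : z ∉ S) :
      w s(a, b) ∈ lowerBounds {x : ℝ | ∃ v ∈ S, x = minDist G w z v} := by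
    rintro x ⟨v, hv, rfl⟩
    exact le_minDist_of_le_crossing hG hw hmin hz hv
  refine (hC.2 S (C \ S) (Set.union_sdiff_cancel hSC.subset).symm Set.disjoint_sdiff_right ⟨a, ha⟩
    (Set.nonempty_of_ssubset hSC) b hb fun z hz => ?_).1
  calc sInf {x : ℝ | ∃ v ∈ S, x = minDist G w b v}
      ≤ minDist G w b a := csInf_le ⟨_, hlow hb⟩ ⟨a, ha, rfl⟩
    _ ≤ w s(a, b) := by
      rw [Sym2.eq_swap]
      exact minDist_le_of_adj hw hab.symm
    _ ≤ sInf {x : ℝ | ∃ v ∈ S, x = minDist G w z v} := le_csInf ⟨_, a, ha, rfl⟩ (hlow hz)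

/-- A nonempty proper subset of a cluster is joined by an edge of every minimum spanning tree
to the rest of the cluster. -/
theorem IsCluster.exists_mst_adj {V : Type*} [Finite V] {G T : SimpleGraph V} {w : Sym2 V → ℝ}
    (hG : G.Connected) (hw : ∀ e ∈ G.edgeSet, 0 < w e ∧ w e ≤ 1) (hT : IsMST G w T)
    {C S : Set V} (hC : IsCluster G w C) (hSC : S ⊂ C) (hS : S.Nonempty) :
    ∃ a ∈ S, ∃ b ∈ C \ S, T.Adj a b := by
  classical
  by_contra! hcon
  let E : Set (V × V) := {e | e.1 ∈ S ∧ e.2 ∉ S ∧ G.Adj e.1 e.2}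
  have hE : E.Nonempty := by
    obtain ⟨u, hu⟩ := hS
    obtain ⟨v, -, hv⟩ := Set.exists_of_ssubset hSC
    obtain ⟨p⟩ := hG.preconnected u v
    obtain ⟨d, -, hfst, hsnd⟩ := p.exists_boundary_dart S hu hv
    exact ⟨(d.fst, d.snd), hfst, hsnd, d.adj⟩
  obtain ⟨⟨a, b⟩, ⟨ha, hb, hab⟩, hmin⟩ :=
    Set.exists_min_image E (fun e => w s(e.1, e.2)) (Set.toFinite _) hE
  have hmin' (a' : V) (ha' : a' ∈ S) (b' : V) (hb' : b' ∉ S) (h : G.Adj a' b') :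
      w s(a, b) ≤ w s(a', b') := hmin (a', b') ⟨ha', hb', h⟩
  have hbC : b ∈ C := hC.mem_of_lightest_crossing hG hw hSC ha hb hab hmin'
  obtain ⟨q₀⟩ := hT.1.2.1.preconnected b a
  obtain ⟨d, hd, hfst, hsnd⟩ := q₀.toPath.1.exists_boundary_dart Sᶜ hb (by simpa using ha)
  have hsnd' : d.snd ∈ S := by simpa using hsnd
  have hle : w s(d.snd, d.fst) ≤ w s(a, b) := by
    rw [Sym2.eq_swap]
    exact hT.weight_le_of_mem_edges hw hab (hcon a ha b ⟨hbC, hb⟩) q₀.toPath.2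
      (List.mem_map_of_mem hd)
  refine hcon d.snd hsnd' d.fst ⟨?_, hfst⟩ d.adj.symm
  exact hC.mem_of_lightest_crossing hG hw hSC hsnd' hfst (hT.1.1 d.adj.symm)
    fun a' ha' b' hb' h => hle.trans (hmin' a' ha' b' hb' h)

/-- Let `T` be an MST of `G`, `C` a cluster, and `v₁, v₂ ∈ C`.
Then every vertex lying on the unique path in `T` from `v₁` to `v₂` belongs to `C`. -/
theorem mst_path_in_cluster {V : Type*} [Fintype V]
    (G : SimpleGraph V) (w : Sym2 V → ℝ)
    (hG : G.Connected) (hw : ∀ e ∈ G.edgeSet, 0 < w e ∧ w e ≤ 1)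
    (T : SimpleGraph V) (hT : IsMST G w T)
    (C : Set V) (hC : IsCluster G w C)
    (v₁ v₂ : V) (hv₁ : v₁ ∈ C) (hv₂ : v₂ ∈ C)
    (p : T.Walk v₁ v₂) (hp : p.IsPath) :
    ∀ x ∈ p.support, x ∈ C := by
  classical
  let S : Set V := {c | ∃ q : T.Walk v₁ c, ∀ y ∈ q.support, y ∈ C}
  have hSC : S ⊆ C := fun c ⟨q, hq⟩ => hq c q.end_mem_support
  have hSeq : S = C := by
    by_contra hne
    have hv₁S : v₁ ∈ S := ⟨.nil, by simpa using hv₁⟩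
    obtain ⟨a, ⟨q, hq⟩, b, ⟨hbC, hbS⟩, hab⟩ :=
      hC.exists_mst_adj hG hw hT (hSC.ssubset_of_ne hne) ⟨v₁, hv₁S⟩
    refine hbS ⟨q.concat hab, fun y hy => ?_⟩
    rw [SimpleGraph.Walk.support_concat] at hy
    simp only [List.mem_append, List.mem_singleton] at hy
    rcases hy with hy | rfl
    exacts [hq y hy, hbC]
  obtain ⟨q, hq⟩ : v₂ ∈ S := hSeq ▸ hv₂
  have hpq : p = q.toPath.1 := 
    congrArg Subtype.val ((hT.1.2.2.subsingleton_path v₁ v₂).elim ⟨p, hp⟩ q.toPath)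
  intro x hx
  rw [hpq] at hx
  exact hq x (q.support_toPath_subset_support hx)
end

section
/- Let T be a minimum spanning tree of G and let C ⊆ V be a cluster. Then the subgraph of T induced on C is connected; that is, the cluster C is spanned by a subtree of T. -/
open scoped BigOperators

open SimpleGraph

/-- Replacing an edge `e` by an edge `f` of smaller weight (and possibly dropping further edges)
strictly decreases the total weight of a graph. -/
lemma totalWeight_lt_of_edgeSet_subset_insert {V : Type*} [Finite V] {w : Sym2 V → ℝ}
    {T T' : SimpleGraph V} {e f : Sym2 V} (he : e ∈ T.edgeSet) (hfe : w f < w e) (hf : 0 ≤ w f)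
    (hT : ∀ e ∈ T.edgeSet, 0 ≤ w e) (h : T'.edgeSet ⊆ insert f (T.edgeSet \ {e})) :
    totalWeight w T' < totalWeight w T := by
  classical
  have := Fintype.ofFinite V
  unfold totalWeight
  rw [finsum_mem_eq_toFinset_sum, finsum_mem_eq_toFinset_sum]
  have hsub : T'.edgeSet.toFinset ⊆ insert f (T.edgeSet.toFinset.erase e) := by
    intro x hx
    have := h (Set.mem_toFinset.1 hx)
    simp only [Set.mem_insert_iff, Set.mem_sdiff, Set.mem_singleton_iff] at this
    simp only [Finset.mem_insert, Finset.mem_erase, Set.mem_toFinset]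
    tauto
  have hle : ∑ x ∈ T'.edgeSet.toFinset, w x ≤ w f + ∑ x ∈ T.edgeSet.toFinset.erase e, w x := by
    refine (Finset.sum_le_sum_of_subset_of_nonneg hsub fun x hx _ ↦ ?_).trans ?_
    · rcases Finset.mem_insert.1 hx with rfl | hx
      · exact hf
      · exact hT x (Set.mem_toFinset.1 (Finset.mem_of_mem_erase hx))
    · by_cases hfm : f ∈ T.edgeSet.toFinset.erase e
      · rw [Finset.insert_eq_of_mem hfm]
        linarith
      · rw [Finset.sum_insert hfm]
  have := Finset.add_sum_erase T.edgeSet.toFinset w (Set.mem_toFinset.2 he)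
  linarith

/-- Exchanging an edge on the tree path between `a` and `b` for the edge `ab`
leaves a connected graph. -/
lemma connected_exchange {V : Type*} {T : SimpleGraph V} (hT : T.Connected) {a b : V}
    (hab : ¬ T.Adj a b) (hne : a ≠ b) {p : T.Walk a b} (hp : p.IsPath) {e : Sym2 V}
    (he : e ∈ p.edges) : ((T ⊔ edge a b).deleteEdges {e}).Connected := by
  have hle : T ≤ T ⊔ edge a b := le_sup_left
  have hba : (T ⊔ edge a b).Adj b a := Or.inr ((edge_adj _ _ _ _).2 ⟨Or.inr ⟨rfl, rfl⟩, hne.symm⟩)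
  have hcycle : (Walk.cons hba (p.mapLe hle)).IsCycle := by
    rw [Walk.cons_isCycle_iff]
    refine ⟨hp.mapLe hle, fun h ↦ hab ?_⟩
    rw [Walk.edges_mapLe_eq_edges] at h
    exact (p.adj_of_mem_edges h).symm
  induction e with | h x y =>
  refine (hT.mono hle).connected_delete_edge_of_not_isBridge fun hbr ↦
    hbr.notMem_edges_of_isCycle hcycle ?_
  simp [he]

/-- In a minimum spanning tree, every edge on the tree path between the endpoints of an edge of
the graph is at most as heavy as that edge. -/
lemma IsMST.weight_le_of_mem_path {V : Type*} [Finite V] {G T : SimpleGraph V} {w : Sym2 V → ℝ}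
    (hw : ∀ e ∈ G.edgeSet, 0 ≤ w e) (hT : IsMST G w T) {a b : V} (hab : G.Adj a b)
    {p : T.Walk a b} (hp : p.IsPath) {e : Sym2 V} (he : e ∈ p.edges) : w e ≤ w s(a, b) := by
  obtain ⟨⟨hTG, hconn, hacyc⟩, hmin⟩ := hT
  by_cases hadj : T.Adj a b
  · have hpath := (hacyc.subsingleton_path a b).elim ⟨p, hp⟩ (Path.singleton hadj)
    have : p = hadj.toWalk := congrArg Subtype.val hpath
    subst this
    simp_all
  by_contra! hlt
  obtain ⟨T', hT', htree⟩ := (connected_exchange hconn hadj hab.ne hp he).exists_isTree_le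
  have hT'G : T' ≤ G := hT'.trans <| (deleteEdges_le _).trans <|
    sup_le hTG <| (edge_le_iff G).2 (Or.inr hab)
  refine (hmin T' ⟨hT'G, htree.connected, htree.isAcyclic⟩).not_gt ?_
  refine totalWeight_lt_of_edgeSet_subset_insert (p.edges_subset_edgeSet he) hlt (hw _ hab)
    (fun e he ↦ hw e (edgeSet_mono hTG he)) ((edgeSet_mono hT').trans ?_)
  rw [edgeSet_deleteEdges, edgeSet_sup, edgeSet_edge_of_ne hab.ne]
  rintro x ⟨hx | hx, hxe⟩
  · exact Or.inr ⟨hx, hxe⟩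
  · exact Or.inl hx

/-- The distance between adjacent vertices is at most the weight of the edge joining them. -/
lemma minDist_le_weight {V : Type*} {G : SimpleGraph V} {w : Sym2 V → ℝ}
    (hw : ∀ e ∈ G.edgeSet, 0 ≤ w e) {u v : V} (huv : G.Adj u v) :
    minDist G w u v ≤ w s(u, v) := by
  refine csInf_le ⟨0, ?_⟩ ⟨huv.toWalk, (Path.singleton huv).2, by simp⟩
  rintro _ ⟨p, -, rfl⟩
  refine List.sum_nonneg fun x hx ↦ ?_
  obtain ⟨e, he, rfl⟩ := List.mem_map.1 hx
  exact hw e (p.edges_subset_edgeSet he)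

/-- A lower bound for the weights of the edges leaving `A` is a lower bound for the distances
from vertices outside `A` to vertices in `A`. -/
lemma le_minDist_of_forall_boundary {V : Type*} {G : SimpleGraph V} {w : Sym2 V → ℝ}
    (hG : G.Connected) (hw : ∀ e ∈ G.edgeSet, 0 ≤ w e) {A : Set V} {m : ℝ}
    (hm : ∀ x ∈ A, ∀ y ∉ A, G.Adj x y → m ≤ w s(x, y)) {z v : V} (hz : z ∉ A) (hv : v ∈ A) :
    m ≤ minDist G w z v := by
  refine le_csInf ?_ ?_
  · obtain ⟨p, hp⟩ := (hG z v).exists_isPath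
    exact ⟨_, p, hp, rfl⟩
  · rintro _ ⟨p, -, rfl⟩
    obtain ⟨d, hd, hd1, hd2⟩ := p.exists_boundary_dart Aᶜ hz (not_not_intro hv)
    have hdp : d.edge ∈ p.edges := List.mem_map_of_mem hd
    have hle : w d.edge ≤ (p.edges.map w).sum := by
      refine List.single_le_sum (fun x hx ↦ ?_) _ (List.mem_map_of_mem hdp)
      obtain ⟨e, he, rfl⟩ := List.mem_map.1 hx
      exact hw e (p.edges_subset_edgeSet he)
    refine le_trans ?_ hle
    have := hm d.snd (not_not.1 hd2) d.fst hd1 d.adj.symm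
    rwa [Sym2.eq_swap] at this

/-- If `C` is a cluster split as `A ∪ B`, then every lightest edge leaving `A` ends in `B`. -/
lemma IsCluster.mem_of_forall_boundary {V : Type*} {G : SimpleGraph V} {w : Sym2 V → ℝ}
    (hG : G.Connected) (hw : ∀ e ∈ G.edgeSet, 0 ≤ w e) {A B : Set V}
    (hC : IsCluster G w (A ∪ B)) (hAB : Disjoint A B) (hB : B.Nonempty) {a b : V}
    (ha : a ∈ A) (hb : b ∉ A) (hab : G.Adj a b)
    (hmin : ∀ x ∈ A, ∀ y ∉ A, G.Adj x y → w s(a, b) ≤ w s(x, y)) : b ∈ B := by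
  refine hC.2 A B rfl hAB ⟨a, ha⟩ hB b hb fun z' hz' ↦ ?_
  have hlb : ∀ z ∉ A, ∀ x ∈ {x : ℝ | ∃ v ∈ A, x = minDist G w z v}, w s(a, b) ≤ x := by
    rintro z hz _ ⟨v, hv, rfl⟩
    exact le_minDist_of_forall_boundary hG hw hmin hz hv
  calc sInf {x : ℝ | ∃ v ∈ A, x = minDist G w b v}
      ≤ minDist G w b a := csInf_le ⟨_, hlb b hb⟩ ⟨a, ha, rfl⟩
    _ ≤ w s(b, a) := minDist_le_weight hw hab.symm
    _ = w s(a, b) := by rw [Sym2.eq_swap]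
    _ ≤ sInf {x : ℝ | ∃ v ∈ A, x = minDist G w z' v} := le_csInf ⟨_, a, ha, rfl⟩ (hlb z' hz')

/-- In a connected finite graph there is a lightest edge leaving any nonempty proper set. -/
lemma exists_lightest_boundary_edge {V : Type*} [Finite V] {G : SimpleGraph V}
    (w : Sym2 V → ℝ) (hG : G.Connected) {A : Set V} {u v : V} (hu : u ∈ A) (hv : v ∉ A) :
    ∃ a ∈ A, ∃ b ∉ A, G.Adj a b ∧ ∀ x ∈ A, ∀ y ∉ A, G.Adj x y → w s(a, b) ≤ w s(x, y) := by
  obtain ⟨p⟩ := hG u v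
  obtain ⟨d, -, hd1, hd2⟩ := p.exists_boundary_dart A hu hv
  obtain ⟨q, ⟨hq1, hq2, hq3⟩, hmin⟩ := Set.exists_min_image
    {q : V × V | q.1 ∈ A ∧ q.2 ∉ A ∧ G.Adj q.1 q.2} (fun q ↦ w s(q.1, q.2)) (Set.toFinite _)
    ⟨(d.fst, d.snd), hd1, hd2, d.adj⟩
  exact ⟨q.1, hq1, q.2, hq2, hq3, fun x hx y hy hxy ↦ hmin (x, y) ⟨hx, hy, hxy⟩⟩

/-- If `C` is a cluster split as `A ∪ B`, then some edge of any minimum spanning tree joins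
`A` and `B`. -/
lemma IsMST.exists_adj_of_isCluster {V : Type*} [Finite V] {G T : SimpleGraph V}
    {w : Sym2 V → ℝ} (hG : G.Connected) (hw : ∀ e ∈ G.edgeSet, 0 ≤ w e) (hT : IsMST G w T)
    {A B : Set V} (hC : IsCluster G w (A ∪ B)) (hAB : Disjoint A B) (hA : A.Nonempty)
    (hB : B.Nonempty) : ∃ x ∈ A, ∃ y ∈ B, T.Adj x y := by
  obtain ⟨u, hu⟩ := hA
  obtain ⟨v, hv⟩ := hB
  obtain ⟨a, ha, b, hb, hab, hmin⟩ :=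
    exists_lightest_boundary_edge w hG hu (hAB.notMem_of_mem_right hv)
  obtain ⟨p, hp⟩ := (hT.1.2.1 a b).exists_isPath
  obtain ⟨d, hd, hd1, hd2⟩ := p.exists_boundary_dart A ha hb
  have hle : w s(d.fst, d.snd) ≤ w s(a, b) :=
    hT.weight_le_of_mem_path hw hab hp (List.mem_map_of_mem hd)
  exact ⟨d.fst, hd1, d.snd, hC.mem_of_forall_boundary hG hw hAB ⟨v, hv⟩ hd1 hd2 (hT.1.1 d.adj)
    fun x hx y hy hxy ↦ hle.trans (hmin x hx y hy hxy), d.adj⟩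

/-- Let `T` be an MST of `G` and `C` a cluster. Then the subgraph
of `T` induced on `C` is connected; that is, `C` is spanned by a subtree of `T`. -/
theorem mst_induced_cluster_connected {V : Type*} [Fintype V]
    (G : SimpleGraph V) (w : Sym2 V → ℝ)
    (hG : G.Connected) (hw : ∀ e ∈ G.edgeSet, 0 < w e ∧ w e ≤ 1)
    (T : SimpleGraph V) (hT : IsMST G w T)
    (C : Set V) (hC : IsCluster G w C) :
    (T.induce C).Connected := by
  have hw' : ∀ e ∈ G.edgeSet, 0 ≤ w e := fun e he ↦ (hw e he).1.le
  obtain ⟨c, hc⟩ : C.Nonempty := Set.nonempty_of_ncard_ne_zero (by have := hC.1; omega)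
  rw [connected_iff_exists_forall_reachable]
  refine ⟨⟨c, hc⟩, ?_⟩
  by_contra! ⟨v, hv⟩
  set A : Set V := Subtype.val '' {x : C | (T.induce C).Reachable ⟨c, hc⟩ x}
  have hAC : A ⊆ C := Subtype.coe_image_subset _ _
  have hunion : A ∪ C \ A = C := Set.union_sdiff_cancel hAC
  obtain ⟨x, ⟨x, hx, rfl⟩, y, ⟨hyC, hyA⟩, hxy⟩ :=
    hT.exists_adj_of_isCluster (A := A) (B := C \ A) hG hw'
      (hunion.symm ▸ hC) Set.disjoint_sdiff_right ⟨c, ⟨c, hc⟩, .rfl, rfl⟩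
      ⟨v, v.2, fun ⟨v', hv', h⟩ ↦ hv (Subtype.ext h ▸ hv')⟩
  have hadj : (T.induce C).Adj x ⟨y, hyC⟩ := hxy
  exact hyA ⟨⟨y, hyC⟩, hx.trans hadj.reachable, rfl⟩
end

section
/- Assume K ≥ 2, assume every cluster C*_i is weakly homogeneous, and let T be a minimum spanning tree of G. Then every edge of T whose weight is maximal among the weights of the edges of T belongs to Cut_G(T). -/
open scoped BigOperators

/-- `Cl : Fin K → Set V` is a ground-truth clustering: the clusters are pairwise
disjoint nonempty subsets of `V` whose union is `V`. -/
def IsClustering {V : Type*} {K : ℕ} (Cl : Fin K → Set V) : Prop :=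
  (∀ i, (Cl i).Nonempty) ∧ (∀ i j, i ≠ j → Disjoint (Cl i) (Cl j)) ∧
    (⋃ i, Cl i) = Set.univ

/-- `Cut_G(T)`: the set of edges of `T` whose two endpoints lie in different
clusters. -/
def cutEdges {V : Type*} {K : ℕ} (T : SimpleGraph V) (Cl : Fin K → Set V) :
    Set (Sym2 V) :=
  {e | e ∈ T.edgeSet ∧
    ∃ u v : V, e = s(u, v) ∧ ∃ i j : Fin K, i ≠ j ∧ u ∈ Cl i ∧ v ∈ Cl j}

/-- Edges of the subgraph `T|C` of `T` induced on the vertex set `C`. -/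
def inducedEdges {V : Type*} (T : SimpleGraph V) (C : Set V) : Set (Sym2 V) :=
  {e | e ∈ T.edgeSet ∧ ∀ v ∈ e, v ∈ C}

/-- Maximum edge weight of the subgraph of `T` induced on `C`. -/
noncomputable def maxWeight {V : Type*} (w : Sym2 V → ℝ) (T : SimpleGraph V)
    (C : Set V) : ℝ :=
  sSup (w '' inducedEdges T C)

/-- Minimum edge weight of the subgraph of `T` induced on `C`. -/
noncomputable def minWeight {V : Type*} (w : Sym2 V → ℝ) (T : SimpleGraph V)
    (C : Set V) : ℝ :=
  sInf (w '' inducedEdges T C)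

/-- `H_{T|C}(s)`: the subgraph of `T` induced on `C` is homogeneously separable by
the edge `s`, i.e. `α · max < w s` where `α = max/min` over edge weights of `T|C`. -/
def HomSep {V : Type*} (w : Sym2 V → ℝ) (T : SimpleGraph V) (C : Set V)
    (s : Sym2 V) : Prop :=
  (maxWeight w T C / minWeight w T C) * maxWeight w T C < w s

/-- Cluster `Cl i` is weakly homogeneous: for every minimum spanning tree `T` of `G`
and every edge `e ∈ Cut_G(T)` with one endpoint in `Cl i`, `H_{T|Cl i}(e)` holds. -/
def WeaklyHomogeneous {V : Type*} {K : ℕ} (G : SimpleGraph V) (w : Sym2 V → ℝ)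
    (Cl : Fin K → Set V) (i : Fin K) : Prop :=
  ∀ T : SimpleGraph V, IsMST G w T →
    ∀ e ∈ cutEdges T Cl, (∃ v ∈ e, v ∈ Cl i) → HomSep w T (Cl i) e

/-- Cluster `Cl i` is strongly homogeneous: for every spanning tree `T` of `G`
and every edge `e ∈ Cut_G(T)` with one endpoint in `Cl i`, `H_{T|Cl i}(e)` holds. -/
def StronglyHomogeneous {V : Type*} {K : ℕ} (G : SimpleGraph V) (w : Sym2 V → ℝ)
    (Cl : Fin K → Set V) (i : Fin K) : Prop :=
  ∀ T : SimpleGraph V, IsSpanningTree G T →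
    ∀ e ∈ cutEdges T Cl, (∃ v ∈ e, v ∈ Cl i) → HomSep w T (Cl i) e

/-- In a connected graph with at least two clusters, every cluster meets some cut edge. -/
theorem exists_mem_cutEdges_inter {V : Type*} {T : SimpleGraph V} (hT : T.Connected)
    {K : ℕ} (hK : 2 ≤ K) {Cl : Fin K → Set V} (hCl : IsClustering Cl) (i : Fin K) :
    ∃ e ∈ cutEdges T Cl, ∃ v ∈ e, v ∈ Cl i := by
  obtain ⟨hne, hdisj, hun⟩ := hCl
  have : Nontrivial (Fin K) := Fin.nontrivial_iff_two_le.mpr hK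
  obtain ⟨j, hj⟩ := exists_ne i
  obtain ⟨x, hx⟩ := hne i
  obtain ⟨y, hy⟩ := hne j
  obtain ⟨p⟩ := hT.preconnected x y
  obtain ⟨d, -, hd, hd'⟩ := p.exists_boundary_dart (Cl i) hx
    (Set.disjoint_left.mp (hdisj j i hj) hy)
  obtain ⟨k, hk⟩ : ∃ k, d.snd ∈ Cl k := Set.mem_iUnion.mp (hun ▸ Set.mem_univ _)
  have hik : i ≠ k := by
    rintro rfl
    exact hd' hk
  exact ⟨s(d.fst, d.snd), ⟨d.adj, d.fst, d.snd, rfl, i, k, hik, hd, hk⟩, d.fst,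
    Sym2.mem_mk_left _ _, hd⟩

/-- An edge that homogeneously separates `T|C` is heavier than every edge of `T|C`. -/
theorem lt_of_homSep {V : Type*} [Finite V] {T : SimpleGraph V} {w : Sym2 V → ℝ} {C : Set V}
    {s e : Sym2 V} (hw : ∀ e ∈ T.edgeSet, 0 < w e) (hs : HomSep w T C s)
    (he : e ∈ inducedEdges T C) : w e < w s := by
  have hfin : (w '' inducedEdges T C).Finite := (Set.toFinite _).image w
  have hmem : w e ∈ w '' inducedEdges T C := Set.mem_image_of_mem w he
  have hle : w e ≤ maxWeight w T C := le_csSup hfin.bddAbove hmem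
  have hge : minWeight w T C ≤ w e := csInf_le hfin.bddBelow hmem
  have hpos : 0 < minWeight w T C := by
    obtain ⟨f, hf, hfw⟩ := Set.Nonempty.csInf_mem ⟨_, hmem⟩ hfin
    exact (hw f hf.1).trans_eq hfw
  have hone : 1 ≤ maxWeight w T C / minWeight w T C := (one_le_div hpos).mpr (hge.trans hle)
  have hmax : 0 ≤ maxWeight w T C := (hpos.le.trans hge).trans hle
  exact (hle.trans (le_mul_of_one_le_left hmax hone)).trans_lt hs

/-- Assume `K ≥ 2`, every cluster weakly homogeneous, `T` an MST
of `G`. Every edge of `T` of maximal weight among the edges of `T` belongs to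
`Cut_G(T)`. -/
theorem heaviest_edge_mem_cutEdges {V : Type*} [Fintype V]
    (G : SimpleGraph V) (w : Sym2 V → ℝ)
    (hG : G.Connected) (hw : ∀ e ∈ G.edgeSet, 0 < w e ∧ w e ≤ 1)
    (K : ℕ) (hK : 2 ≤ K) (Cl : Fin K → Set V) (hCl : IsClustering Cl)
    (hhom : ∀ i, WeaklyHomogeneous G w Cl i)
    (T : SimpleGraph V) (hT : IsMST G w T) :
    ∀ e ∈ T.edgeSet, (∀ e' ∈ T.edgeSet, w e' ≤ w e) → e ∈ cutEdges T Cl := by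
  intro e he hmax
  obtain ⟨hne, hdisj, hun⟩ := hCl
  have hmem (x : V) : ∃ k, x ∈ Cl k := Set.mem_iUnion.mp (hun ▸ Set.mem_univ x)
  by_contra hcut
  induction e using Sym2.ind with
  | _ a b =>
  obtain ⟨i, hai⟩ := hmem a
  have hbi : b ∈ Cl i := by
    obtain ⟨j, hbj⟩ := hmem b
    by_cases hij : i = j
    · exact hij ▸ hbj
    · exact absurd ⟨he, a, b, rfl, i, j, hij, hai, hbj⟩ hcut
  obtain ⟨s, hs, hsi⟩ := exists_mem_cutEdges_inter hT.1.2.1 hK ⟨hne, hdisj, hun⟩ i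
  have hind : s(a, b) ∈ inducedEdges T (Cl i) := by
    refine ⟨he, fun v hv => ?_⟩
    rcases Sym2.mem_iff.mp hv with rfl | rfl
    exacts [hai, hbi]
  have hpos : ∀ f ∈ T.edgeSet, 0 < w f := fun f hf =>
    (hw f (SimpleGraph.edgeSet_mono hT.1.1 hf)).1
  exact (hmax s hs.1).not_gt (lt_of_homSep hpos (hhom i T hT s hs hsi) hind)
end

section
/- For all neighboring weight functions w ∼ w' and every r ∈ R, the exponential mechanism satisfies P_w(r) ≤ e^ε · P_{w'}(r); in particular, the exponential mechanism is ε-differentially private. -/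
open scoped BigOperators Classical

/-- Two weight functions on `E` are neighboring: `max_{e ∈ E} |w e − w' e| ≤ μ`. -/
def Neighboring {E : Type*} (μ : ℝ) (w w' : E → ℝ) : Prop :=
  ∀ e : E, |w e - w' e| ≤ μ

/-- The exponential mechanism over a finite range `R` with utility `u`, sensitivity
`Δu` and privacy parameter `ε`: it outputs `r` with probability
`exp(ε·u(w,r)/(2Δu)) / Σ_{r'} exp(ε·u(w,r')/(2Δu))`. -/
noncomputable def expMech {E R : Type*} [Fintype R] (u : (E → ℝ) → R → ℝ)
    (Δu ε : ℝ) (w : E → ℝ) (r : R) : ℝ :=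
  Real.exp (ε * u w r / (2 * Δu)) / ∑ r' : R, Real.exp (ε * u w r' / (2 * Δu))

/-- A pointwise change of the scores by at most `Δu` multiplies each exponential weight by at most
`exp (ε / 2)`. -/
theorem exp_score_le {a b Δu ε : ℝ} (hΔu : 0 < Δu) (hε : 0 < ε) (h : a - b ≤ Δu) :
    Real.exp (ε * a / (2 * Δu)) ≤ Real.exp (ε / 2) * Real.exp (ε * b / (2 * Δu)) := by
  rw [← Real.exp_add, Real.exp_le_exp, ← sub_le_iff_le_add, ← sub_div, ← mul_sub,
    div_le_iff₀ (by positivity)]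
  calc ε * (a - b) ≤ ε * Δu := by gcongr
    _ = ε / 2 * (2 * Δu) := by ring

/-- If the utilities at `w` and `w'` differ by at most `Δu`, the output probabilities of the
exponential mechanism differ by a factor of at most `exp ε`. -/
theorem expMech_le_exp_mul {E R : Type*} [Fintype R] [Nonempty R] {u : (E → ℝ) → R → ℝ}
    {Δu ε : ℝ} (hΔu : 0 < Δu) (hε : 0 < ε) {w w' : E → ℝ}
    (h : ∀ r, |u w r - u w' r| ≤ Δu) (r : R) :
    expMech u Δu ε w r ≤ Real.exp ε * expMech u Δu ε w' r := by
  have hpos (v : E → ℝ) : 0 < ∑ r' : R, Real.exp (ε * u v r' / (2 * Δu)) :=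
    Finset.sum_pos (fun _ _ => Real.exp_pos _) Finset.univ_nonempty
  have hnum := exp_score_le hΔu hε (abs_le.mp (h r)).2
  have hden : ∑ r' : R, Real.exp (ε * u w' r' / (2 * Δu)) ≤
      Real.exp (ε / 2) * ∑ r' : R, Real.exp (ε * u w r' / (2 * Δu)) := by
    rw [Finset.mul_sum]
    exact Finset.sum_le_sum fun r' _ =>
      exp_score_le hΔu hε (by linarith [(abs_le.mp (h r')).1])
  unfold expMech
  rw [← mul_div_assoc, div_le_div_iff₀ (hpos w) (hpos w')]
  calc _ ≤ (Real.exp (ε / 2) * Real.exp (ε * u w' r / (2 * Δu))) *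
        (Real.exp (ε / 2) * ∑ r' : R, Real.exp (ε * u w r' / (2 * Δu))) :=
        mul_le_mul hnum hden (hpos w').le (by positivity)
    _ = _ := by
      rw [show Real.exp ε = Real.exp (ε / 2) * Real.exp (ε / 2) by
        rw [← Real.exp_add, add_halves]]
      ring

/-- For all neighboring weight functions `w ∼ w'` and every
`r ∈ R`, the exponential mechanism satisfies `P_w(r) ≤ e^ε · P_{w'}(r)`; in
particular (summing over any event `S ⊆ R`) it is `ε`-differentially private. -/
theorem expMech_dp {E R : Type*} [Fintype R] [Nonempty R] (μ : ℝ) (hμ : 0 < μ)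
    (u : (E → ℝ) → R → ℝ) (Δu : ℝ)
    (hΔu : IsLUB {x : ℝ | ∃ (r : R) (w w' : E → ℝ), Neighboring μ w w' ∧
      x = |u w r - u w' r|} Δu)
    (hΔupos : 0 < Δu) (ε : ℝ) (hε : 0 < ε) :
    ∀ w w' : E → ℝ, Neighboring μ w w' →
      (∀ r : R, expMech u Δu ε w r ≤ Real.exp ε * expMech u Δu ε w' r) ∧
      ∀ S : Finset R, ∑ r ∈ S, expMech u Δu ε w r ≤
        Real.exp ε * ∑ r ∈ S, expMech u Δu ε w' r := by
  intro w w' hw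
  have hpt := expMech_le_exp_mul hΔupos hε (fun r => hΔu.1 ⟨r, w, w', hw, rfl⟩)
  refine ⟨hpt, fun S => ?_⟩
  rw [Finset.mul_sum]
  exact Finset.sum_le_sum fun r _ => hpt r
end

section
/- Let OPT_w = max_{r ∈ R} u(w, r). For every weight function w and every real t, the exponential mechanism satisfies P_w({r ∈ R : u(w, r) ≤ OPT_w − (2Δu/ε)·(t + ln|R|)}) ≤ exp(−t); that is, the mechanism outputs an element whose utility is within (2Δu/ε)(t + ln|R|) of optimal except with probability at most e^{−t}. -/
open scoped BigOperators Classical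

/-- The exponential mechanism outputs any fixed element whose utility is at least
`(2Δu/ε)·s` below optimal with probability at most `e^{−s}`. -/
theorem expMech_le_exp_neg {E R : Type*} [Fintype R] [Nonempty R]
    (u : (E → ℝ) → R → ℝ) {Δu ε : ℝ} (hΔu : 0 < Δu) (hε : 0 < ε) (w : E → ℝ) {s : ℝ} {r : R}
    (hr : u w r ≤ (⨆ r' : R, u w r') - (2 * Δu / ε) * s) :
    expMech u Δu ε w r ≤ Real.exp (-s) := by
  obtain ⟨m, hm⟩ := exists_eq_ciSup_of_finite (f := u w)
  rw [← hm] at hr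
  have hsum : Real.exp (ε * u w m / (2 * Δu)) ≤ ∑ r' : R, Real.exp (ε * u w r' / (2 * Δu)) :=
    Finset.single_le_sum (f := fun r' => Real.exp (ε * u w r' / (2 * Δu)))
      (fun _ _ => (Real.exp_pos _).le) (Finset.mem_univ m)
  have hexp : ε * u w r / (2 * Δu) ≤ -s + ε * u w m / (2 * Δu) := by
    calc ε * u w r / (2 * Δu) ≤ ε * (u w m - (2 * Δu / ε) * s) / (2 * Δu) := by gcongr
      _ = -s + ε * u w m / (2 * Δu) := by field_simp; ring
  rw [expMech, div_le_iff₀ ((Real.exp_pos _).trans_le hsum)]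
  calc Real.exp (ε * u w r / (2 * Δu)) ≤ Real.exp (-s) * Real.exp (ε * u w m / (2 * Δu)) := by
        rw [← Real.exp_add]
        exact Real.exp_le_exp.mpr hexp
    _ ≤ _ := by gcongr

/-- Accuracy of the exponential mechanism: with
`OPT_w = max_{r ∈ R} u (w, r)`, for every weight function `w` and every real `t`,
the probability that the output `r` satisfies
`u (w, r) ≤ OPT_w − (2Δu/ε)·(t + ln |R|)` is at most `e^{−t}`. -/
theorem expMech_accuracy {E R : Type*} [Fintype R] [Nonempty R] (μ : ℝ) (hμ : 0 < μ)
    (u : (E → ℝ) → R → ℝ) (Δu : ℝ)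
    (hΔu : IsLUB {x : ℝ | ∃ (r : R) (w w' : E → ℝ), Neighboring μ w w' ∧
      x = |u w r - u w' r|} Δu)
    (hΔupos : 0 < Δu) (ε : ℝ) (hε : 0 < ε) :
    ∀ (w : E → ℝ) (t : ℝ),
      ∑ r ∈ Finset.univ.filter (fun r : R =>
          u w r ≤ (⨆ r' : R, u w r') -
            (2 * Δu / ε) * (t + Real.log (Fintype.card R))),
        expMech u Δu ε w r ≤ Real.exp (-t) := by
  intro w t
  have hcard : (0 : ℝ) < Fintype.card R := by exact_mod_cast Fintype.card_pos
  refine (Finset.sum_le_card_nsmul _ _ _ fun r hr =>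
    expMech_le_exp_neg u hΔupos hε w (Finset.mem_filter.mp hr).2).trans ?_
  rw [nsmul_eq_mul, neg_add, Real.exp_add, Real.exp_neg (Real.log _), Real.exp_log hcard]
  calc _ ≤ (Fintype.card R : ℝ) * (Real.exp (-t) * (Fintype.card R : ℝ)⁻¹) := by
        gcongr
        exact Finset.card_le_univ _
    _ = Real.exp (-t) := by field_simp
end

section
/- Let ε₁, ε₂ > 0 and δ₁, δ₂ ≥ 0. Let (M¹_w) be a family of probability measures on a measurable space B₁, indexed by weight functions on E, that is (ε₁, δ₁)-differentially private, and for each weight function w let b ↦ M²_{w,b} be a Markov kernel from B₁ to a measurable space B₂ such that for every fixed b ∈ B₁ the family (M²_{w,b})_w is (ε₂, δ₂)-differentially private. Then the family of composed measures on B₁ × B₂ defined by S ↦ ∫_{B₁} M²_{w,b}({y ∈ B₂ : (b, y) ∈ S}) dM¹_w(b) is (ε₁ + ε₂, δ₁ + δ₂)-differentially private; in particular, the adaptive composition of two (ε, δ)-differentially private mechanisms is (2ε, 2δ)-differentially private. -/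
open MeasureTheory ProbabilityTheory
open scoped ENNReal

/-- A family `(M_w)` of probability measures on `B`, indexed by weight functions on
`E`, is `(ε, δ)`-differentially private: for all neighboring `w ∼ w'` and every
measurable `S ⊆ B`, `M_w(S) ≤ e^ε · M_{w'}(S) + δ`. -/
def IsDP {E B : Type*} [MeasurableSpace B] (μ : ℝ) (M : (E → ℝ) → Measure B)
    (ε δ : ℝ) : Prop :=
  ∀ w w' : E → ℝ, Neighboring μ w w' →
    ∀ S : Set B, MeasurableSet S →
      M w S ≤ ENNReal.ofReal (Real.exp ε) * M w' S + ENNReal.ofReal δ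

/-- An approximate domination `ν S ≤ c * ν' S + d` on measurable sets extends to integrals of
measurable functions with values in `[0, 1]`. -/
theorem lintegral_le_mul_lintegral_add_of_le_one {α : Type*} [MeasurableSpace α]
    {ν ν' : Measure α} {c d : ℝ≥0∞}
    (h : ∀ S : Set α, MeasurableSet S → ν S ≤ c * ν' S + d)
    {f : α → ℝ≥0∞} (hf : Measurable f) (hf_le : ∀ a, f a ≤ 1) :
    ∫⁻ a, f a ∂ν ≤ c * ∫⁻ a, f a ∂ν' + d := by
  have layercake (ρ : Measure α) :
      ∫⁻ a, f a ∂ρ = ∫⁻ t in Set.Ioi (0 : ℝ), ρ {a | t < (f a).toReal} := by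
    rw [← lintegral_eq_lintegral_meas_lt ρ (ae_of_all _ fun a => ENNReal.toReal_nonneg)
      hf.ennreal_toReal.aemeasurable]
    exact lintegral_congr fun a =>
      (ENNReal.ofReal_toReal ((hf_le a).trans_lt ENNReal.one_lt_top).ne).symm
  have meas_superlevel : Measurable fun t : ℝ => ν' {a | t < (f a).toReal} :=
    Antitone.measurable fun s t hst => measure_mono fun a (ha : t < _) => hst.trans_lt ha
  have superlevel_le (t : ℝ) : ν {a | t < (f a).toReal} ≤
      c * ν' {a | t < (f a).toReal} + (Set.Iio (1 : ℝ)).indicator (fun _ => d) t := by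
    by_cases ht : t < 1
    · rw [Set.indicator_of_mem (show t ∈ Set.Iio (1 : ℝ) from ht)]
      exact h _ (measurableSet_lt measurable_const hf.ennreal_toReal)
    · have hempty : {a | t < (f a).toReal} = ∅ := by
        refine Set.eq_empty_of_forall_notMem fun a (ha : t < _) => ht (ha.trans_le ?_)
        exact ENNReal.toReal_le_of_le_ofReal zero_le_one (by simpa using hf_le a)
      simp [hempty]
  rw [layercake ν, layercake ν']
  calc ∫⁻ t in Set.Ioi (0 : ℝ), ν {a | t < (f a).toReal}
      ≤ ∫⁻ t in Set.Ioi (0 : ℝ), (c * ν' {a | t < (f a).toReal} +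
          (Set.Iio (1 : ℝ)).indicator (fun _ => d) t) := lintegral_mono superlevel_le
    _ = c * (∫⁻ t in Set.Ioi (0 : ℝ), ν' {a | t < (f a).toReal}) + d := by
      rw [lintegral_add_left (meas_superlevel.const_mul c),
        lintegral_const_mul _ meas_superlevel, lintegral_indicator_const measurableSet_Iio,
        Measure.restrict_apply measurableSet_Iio, Set.Iio_inter_Ioi, Real.volume_Ioo]
      simp

/-- **adaptive composition.** Let `(M¹_w)` be an
`(ε₁, δ₁)`-differentially private family of probability measures on `B₁` and, for
each weight function `w`, let `M²_w` be a Markov kernel from `B₁` to `B₂` such that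
for every fixed `b ∈ B₁` the family `(M²_{w,b})_w` is `(ε₂, δ₂)`-differentially
private. Then the composed family on `B₁ × B₂`, defined on a measurable set `S` by
`S ↦ ∫_{B₁} M²_{w,b} {y : (b, y) ∈ S} dM¹_w(b)`, is
`(ε₁ + ε₂, δ₁ + δ₂)`-differentially private; in particular the adaptive composition
of two `(ε, δ)`-differentially private mechanisms is `(2ε, 2δ)`-differentially
private. -/
theorem adaptiveComposition_dp {E B₁ B₂ : Type*}
    [MeasurableSpace B₁] [MeasurableSpace B₂]
    (μ : ℝ) (hμ : 0 < μ) (ε₁ ε₂ δ₁ δ₂ : ℝ)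
    (hε₁ : 0 < ε₁) (hε₂ : 0 < ε₂) (hδ₁ : 0 ≤ δ₁) (hδ₂ : 0 ≤ δ₂)
    (M₁ : (E → ℝ) → Measure B₁) (hprob : ∀ w, IsProbabilityMeasure (M₁ w))
    (hM₁ : IsDP μ M₁ ε₁ δ₁)
    (M₂ : (E → ℝ) → Kernel B₁ B₂) (hmarkov : ∀ w, IsMarkovKernel (M₂ w))
    (hM₂ : ∀ b : B₁, IsDP μ (fun w => M₂ w b) ε₂ δ₂) :
    ∀ w w' : E → ℝ, Neighboring μ w w' →
      ∀ S : Set (B₁ × B₂), MeasurableSet S →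
        (∫⁻ b, M₂ w b {y : B₂ | (b, y) ∈ S} ∂(M₁ w)) ≤
          ENNReal.ofReal (Real.exp (ε₁ + ε₂)) *
              (∫⁻ b, M₂ w' b {y : B₂ | (b, y) ∈ S} ∂(M₁ w')) +
            ENNReal.ofReal (δ₁ + δ₂) := by
  intro w w' hw S hS
  have := hprob w
  have := hmarkov w
  have := hmarkov w'
  set g : B₁ → ℝ≥0∞ := fun b => M₂ w' b {y : B₂ | (b, y) ∈ S}
  have hg : Measurable g := Kernel.measurable_kernel_prodMk_left hS
  set c₂ := ENNReal.ofReal (Real.exp ε₂)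
  have hmin : Measurable fun b => min (c₂ * g b) 1 := (hg.const_mul c₂).min measurable_const
  have section_le (b : B₁) : M₂ w b {y : B₂ | (b, y) ∈ S} ≤
      min (c₂ * g b) 1 + ENNReal.ofReal δ₂ := by
    rw [← min_add_add_right]
    exact le_min (hM₂ b w w' hw _ (measurable_prodMk_left hS))
      (prob_le_one.trans le_self_add)
  calc (∫⁻ b, M₂ w b {y : B₂ | (b, y) ∈ S} ∂(M₁ w))
      ≤ ∫⁻ b, (min (c₂ * g b) 1 + ENNReal.ofReal δ₂) ∂(M₁ w) := lintegral_mono section_le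
    _ = (∫⁻ b, min (c₂ * g b) 1 ∂(M₁ w)) + ENNReal.ofReal δ₂ := by
      rw [lintegral_add_left hmin]
      simp
    _ ≤ ENNReal.ofReal (Real.exp ε₁) * (∫⁻ b, min (c₂ * g b) 1 ∂(M₁ w')) +
          ENNReal.ofReal δ₁ + ENNReal.ofReal δ₂ := by
      gcongr
      exact lintegral_le_mul_lintegral_add_of_le_one (hM₁ w w' hw) hmin
        fun b => min_le_right _ _
    _ ≤ ENNReal.ofReal (Real.exp ε₁) * (∫⁻ b, c₂ * g b ∂(M₁ w')) +
          ENNReal.ofReal δ₁ + ENNReal.ofReal δ₂ := by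
      gcongr
      exact min_le_left _ _
    _ = ENNReal.ofReal (Real.exp (ε₁ + ε₂)) * (∫⁻ b, g b ∂(M₁ w')) +
          ENNReal.ofReal (δ₁ + δ₂) := by
      rw [lintegral_const_mul _ hg, ← mul_assoc, Real.exp_add,
        ENNReal.ofReal_mul (Real.exp_pos _).le, ENNReal.ofReal_add hδ₁ hδ₂, add_assoc]
end
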